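/- Let D_1,…,D_q be hypersurfaces in ℂP^M in N-subgeneral position in a smooth projective variety V ⊂ ℂP^M of dimension n, where N ≥ n and q ≥ 2N−n+1. Then there exists a chain of subsets ∅ = R_0 ⊊ R_1 ⊊ ⋯ ⊊ R_s ⊆ Q = {1,…,q} (s ≥ 0) such that: (i) c(R_s) < n+1; (ii) 0 < ρ(R_0,R_1) < ρ(R_1,R_2) < ⋯ < ρ(R_{s−1},R_s) < (n+1−c(R_s))/(2N−n+1−#R_s); (iii) for any R with R_{i−1} ⊊ R ⊆ Q (1 ≤ i ≤ s) and c(R_{i−1}) < c(R) < n+1, one has ρ(R_{i−1},R_i) ≤ ρ(R_{i−1},R), and if ρ(R_{i−1},R_i) = ρ(R_{i−1},R) then #R ≤ #R_i; (iv) for any R with R_s ⊊ R ⊆ Q, if c(R_s) < c(R) < n+1 then ρ(R_s,R) ≥ (n+1−c(R_s))/(2N−n+1−#R_s). -/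

import Mathlib

open MvPolynomial Filter

noncomputable section

namespace SMT

/-- The affine cone in `ℂ^K` cut out by an ideal of polynomials
(the common zero set of all its members). -/
def coneOf {K : ℕ} (I : Ideal (MvPolynomial (Fin K) ℂ)) : Set (Fin K → ℂ) :=
  {x | ∀ Q ∈ I, MvPolynomial.eval x Q = 0}

/-- The vanishing ideal of a subset of `ℂ^K`. -/
def vIdeal {K : ℕ} (A : Set (Fin K → ℂ)) : Ideal (MvPolynomial (Fin K) ℂ) where
  carrier := {Q | ∀ x ∈ A, MvPolynomial.eval x Q = 0}
  add_mem' := by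
    intro a b ha hb x hx
    simp [ha x hx, hb x hx]
  zero_mem' := by
    intro x hx
    simp
  smul_mem' := by
    intro c p hp x hx
    simp [smul_eq_mul, hp x hx]

/-- The dimension of (the affine cone over) a subset of `ℂ^K`:
the Krull dimension of its coordinate ring, read off as a natural number. -/
def coneDim {K : ℕ} (A : Set (Fin K → ℂ)) : ℕ :=
  ENat.toNat ((ringKrullDim (MvPolynomial (Fin K) ℂ ⧸ vIdeal A)).unbotD 0)

/-- `I` is the homogeneous (prime) ideal of a complex projective variety of dimension `n`
in `ℂP^{K-1}`: it is prime, generated by homogeneous polynomials, and the affine cone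
has Krull dimension `n + 1`. -/
def IsVariety {K : ℕ} (n : ℕ) (I : Ideal (MvPolynomial (Fin K) ℂ)) : Prop :=
  I.IsPrime ∧
  (∃ S : Set (MvPolynomial (Fin K) ℂ), (∀ Q ∈ S, ∃ e, Q.IsHomogeneous e) ∧ I = Ideal.span S) ∧
  ringKrullDim (MvPolynomial (Fin K) ℂ ⧸ I) = (((n + 1 : ℕ) : ℕ∞) : WithBot ℕ∞)

/-- A smooth complex projective variety of dimension `n` in `ℂP^{K-1}`, presented by its
homogeneous prime ideal: smoothness via the Jacobian criterion at every nonzero point of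
the affine cone. -/
def IsSmoothVariety {K : ℕ} (n : ℕ) (I : Ideal (MvPolynomial (Fin K) ℂ)) : Prop :=
  IsVariety n I ∧
  ∀ x ∈ coneOf I, x ≠ 0 →
    Module.finrank ℂ (Submodule.span ℂ
      {v : Fin K → ℂ | ∃ Q ∈ I, v = fun i => MvPolynomial.eval x (MvPolynomial.pderiv i Q)})
      = K - 1 - n

/-- The affine cone over the hypersurface defined by a homogeneous polynomial. -/
def hypCone {K : ℕ} (Q : MvPolynomial (Fin K) ℂ) : Set (Fin K → ℂ) :=
  {x | MvPolynomial.eval x Q = 0}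

/-- The affine cone over `V ∩ (∩_{j ∈ R} D_j)`. -/
def interCone {K q : ℕ} (I : Ideal (MvPolynomial (Fin K) ℂ))
    (Q : Fin q → MvPolynomial (Fin K) ℂ) (R : Finset (Fin q)) : Set (Fin K → ℂ) :=
  coneOf I ∩ ⋂ j ∈ R, hypCone (Q j)

/-- The codimension function `c(R) = codim_V (V ∩ ∩_{j∈R} D_j)`, with `c(∅) = 0` and
the convention `codim ∅ = n+1` (the cone over the empty projective set is `{0}`,
of cone dimension `0`). -/
def cdim {K q : ℕ} (n : ℕ) (I : Ideal (MvPolynomial (Fin K) ℂ))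
    (Q : Fin q → MvPolynomial (Fin K) ℂ) (R : Finset (Fin q)) : ℕ :=
  n + 1 - coneDim (interCone I Q R)

/-- `ρ(R₁,R₂) = (c(R₂) - c(R₁)) / (#R₂ - #R₁)`. -/
def rho {K q : ℕ} (n : ℕ) (I : Ideal (MvPolynomial (Fin K) ℂ))
    (Q : Fin q → MvPolynomial (Fin K) ℂ) (R₁ R₂ : Finset (Fin q)) : ℝ :=
  ((cdim n I Q R₂ : ℝ) - (cdim n I Q R₁ : ℝ)) / ((R₂.card : ℝ) - (R₁.card : ℝ))

/-- The hypersurfaces `D_j = {Q j = 0}`, `j ∈ S`, are in general position in the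
projective variety `V` (of dimension `n`) defined by `I`: any `s` of them (`1 ≤ s ≤ n+1`)
can be complemented by `n+1-s` further hypersurfaces so that the total intersection with
`V` is empty (in projective space, i.e. the cones meet only in `0`). -/
def GenPos {K q : ℕ} (n : ℕ) (I : Ideal (MvPolynomial (Fin K) ℂ))
    (Q : Fin q → MvPolynomial (Fin K) ℂ) (S : Finset (Fin q)) : Prop :=
  ∀ J : Finset (Fin q), J ⊆ S → 1 ≤ J.card → J.card ≤ n + 1 →
    ∃ Q' : Fin (n + 1 - J.card) → MvPolynomial (Fin K) ℂ,
      (∀ k, ∃ e, 1 ≤ e ∧ (Q' k).IsHomogeneous e) ∧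
      ∀ x ∈ interCone I Q J, (∀ k, MvPolynomial.eval x (Q' k) = 0) → x = 0

/-- A set is algebraic if it is the zero set of its vanishing ideal. -/
def IsAlgSet {K : ℕ} (A : Set (Fin K → ℂ)) : Prop := A = coneOf (vIdeal A)

/-- `σ` is an irreducible component of `S`: an algebraic irreducible subset of `S`,
maximal among such. -/
def IsIrredComponent {K : ℕ} (σ S : Set (Fin K → ℂ)) : Prop :=
  σ ⊆ S ∧ IsAlgSet σ ∧ (vIdeal σ).IsPrime ∧
  ∀ τ : Set (Fin K → ℂ), τ ⊆ S → IsAlgSet τ → (vIdeal τ).IsPrime → σ ⊆ τ → σ = τ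

/-- Condition (i) of Definition 1.1: any `N+1` of the hypersurfaces meet `V` in the
empty (projective) set. -/
def SubgenI {K q : ℕ} (N : ℕ) (I : Ideal (MvPolynomial (Fin K) ℂ))
    (Q : Fin q → MvPolynomial (Fin K) ℂ) : Prop :=
  ∀ J : Finset (Fin q), J.card = N + 1 → ∀ x ∈ interCone I Q J, x = 0

/-- Condition (ii) of Definition 1.1. -/
def SubgenII {K q : ℕ} (n : ℕ) (I : Ideal (MvPolynomial (Fin K) ℂ))
    (Q : Fin q → MvPolynomial (Fin K) ℂ) : Prop :=
  ∀ J : Finset (Fin q), 0 < J.card → J.card ≤ n + 1 → GenPos n I Q J →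
    (∃ x ∈ interCone I Q J, x ≠ 0) →
    ∃ σ : Set (Fin K → ℂ), IsIrredComponent σ (interCone I Q J) ∧
      coneDim σ = coneDim (interCone I Q J) ∧
      ∀ i ∉ J, coneDim (interCone I Q (insert i J)) = coneDim (interCone I Q J) →
        σ ⊆ hypCone (Q i)

/-- The hypersurfaces `D_j = {Q j = 0}` are in `N`-subgeneral position in the projective
variety `V` defined by `I` (Definition 1.1), including the requirement `V ⊄ D_j`. -/
def InSubgenPos {K q : ℕ} (n N : ℕ) (I : Ideal (MvPolynomial (Fin K) ℂ))
    (Q : Fin q → MvPolynomial (Fin K) ℂ) : Prop :=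
  (∀ j, ¬ (coneOf I ⊆ hypCone (Q j))) ∧ SubgenI N I Q ∧ SubgenII n I Q

/-- The Hilbert function `H_X(m) = dim_ℂ ℂ[x]_m / I(m)` of (the variety with homogeneous
ideal) `I`. -/
def hilbert {K : ℕ} (I : Ideal (MvPolynomial (Fin K) ℂ)) (m : ℕ) : ℕ :=
  Module.finrank ℂ
    ((MvPolynomial.homogeneousSubmodule (Fin K) ℂ m) ⧸
      (Submodule.comap (MvPolynomial.homogeneousSubmodule (Fin K) ℂ m).subtype
        (Submodule.restrictScalars ℂ I)))

/-- The degree of an `n`-dimensional projective variety with homogeneous ideal `I`: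
the (unique) natural number `Δ` with `H(m) = Δ·mⁿ/n! + O(m^{n-1})`. -/
def pdeg {K : ℕ} (n : ℕ) (I : Ideal (MvPolynomial (Fin K) ℂ)) : ℕ :=
  sInf {Δ : ℕ | Filter.Tendsto
    (fun m : ℕ => (hilbert I m : ℝ) * (n.factorial : ℝ) / (m : ℝ) ^ n)
    Filter.atTop (nhds (Δ : ℝ))}

/-- The image cone of the cone of `I` under `x ↦ (Q_1(x), …, Q_q(x))`. -/
def imgCone {K q : ℕ} (I : Ideal (MvPolynomial (Fin K) ℂ))
    (Q : Fin q → MvPolynomial (Fin K) ℂ) : Set (Fin q → ℂ) :=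
  (fun x j => MvPolynomial.eval x (Q j)) '' coneOf I

/-! Nevanlinna-theoretic notions. -/

/-- `‖f(z)‖ = max_i |f_i(z)|` for a tuple of functions. -/
def projNorm {ι : Type*} [Fintype ι] (f : ι → ℂ → ℂ) (z : ℂ) : ℝ :=
  ⨆ i, ‖f i z‖

/-- The Nevanlinna characteristic function
`T_f(r) = (2π)⁻¹ ∫_0^{2π} log ‖f(re^{iθ})‖ dθ`. -/
def charFn {ι : Type*} [Fintype ι] (f : ι → ℂ → ℂ) (r : ℝ) : ℝ :=
  (2 * Real.pi)⁻¹ *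
    ∫ θ in (0:ℝ)..(2 * Real.pi),
      Real.log (projNorm f ((r : ℂ) * Complex.exp ((θ : ℂ) * Complex.I)))

/-- The vanishing order of an entire function at a point (the zero divisor). -/
def zeroOrder (φ : ℂ → ℂ) (z : ℂ) : ℕ :=
  sInf {k : ℕ | iteratedDeriv k φ z ≠ 0}

/-- The (unintegrated) counting function `N_φ(r)` of the zero divisor of `φ`. -/
def count (φ : ℂ → ℂ) (r : ℝ) : ℝ :=
  ∫ t in (1:ℝ)..r, (∑ᶠ z ∈ {z : ℂ | ‖z‖ < t}, ((zeroOrder φ z : ℕ) : ℝ)) / t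

/-- The counting function truncated at level `L`. -/
def countTrunc (L : ℕ) (φ : ℂ → ℂ) (r : ℝ) : ℝ :=
  ∫ t in (1:ℝ)..r,
    (∑ᶠ z ∈ {z : ℂ | ‖z‖ < t}, ((min (zeroOrder φ z) L : ℕ) : ℝ)) / t

/-- A tuple of entire functions without common zeros (a reduced representation of a
holomorphic curve in projective space). -/
def ReducedRepr {ι : Type*} [Fintype ι] (f : ι → ℂ → ℂ) : Prop :=
  (∀ i, Differentiable ℂ (f i)) ∧ ∀ z, ∃ i, f i z ≠ 0

/-- The entire function `Q(f_0, …, f_{K-1})`. -/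
def polyComp {K : ℕ} (Q : MvPolynomial (Fin K) ℂ) (f : Fin K → ℂ → ℂ) : ℂ → ℂ :=
  fun z => MvPolynomial.eval (fun i => f i z) Q

/-- The curve with reduced representation `f` has image inside the variety of `I`. -/
def MapsIntoCone {K : ℕ} (f : Fin K → ℂ → ℂ) (I : Ideal (MvPolynomial (Fin K) ℂ)) : Prop :=
  ∀ z, (fun i => f i z) ∈ coneOf I

/-- `f` is an algebraically nondegenerate holomorphic map into the variety of `I`:
its image is contained in `V` but in no proper algebraic subvariety of `V`. -/
def AlgNondeg {K : ℕ} (f : Fin K → ℂ → ℂ) (I : Ideal (MvPolynomial (Fin K) ℂ)) : Prop :=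
  MapsIntoCone f I ∧
  ∀ P : MvPolynomial (Fin K) ℂ, (∃ e, P.IsHomogeneous e) → P ∉ I →
    ∃ z, polyComp P f z ≠ 0

/-- `P r` holds for all `r ∈ [1,∞)` outside a Borel subset `E` of `(1,∞)` of finite
Lebesgue measure. -/
def ExcSMT (P : ℝ → Prop) : Prop :=
  ∃ E : Set ℝ, MeasurableSet E ∧ E ⊆ Set.Ioi 1 ∧ MeasureTheory.volume E < ⊤ ∧
    ∀ r : ℝ, 1 ≤ r → r ∉ E → P r

/-- Existence of an optimal next element. -/
lemma exists_opt {α : Type*} (S : Finset (Finset α)) (hS : S.Nonempty) (r : Finset α → ℝ) :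
    ∃ T ∈ S, ∀ U ∈ S, r T ≤ r U ∧ (r T = r U → U.card ≤ T.card) := by
  obtain ⟨A, hA, hmin⟩ := S.exists_min_image r hS
  obtain ⟨T, hT, hmax⟩ := (S.filter (fun U => r U = r A)).exists_max_image Finset.card
    ⟨A, by simp [hA]⟩
  simp only [Finset.mem_filter] at hT hmax
  refine ⟨T, hT.1, fun U hU => ⟨hT.2 ▸ hmin U hU, fun h => hmax U ⟨hU, ?_⟩⟩⟩
  rw [← h, hT.2]

/-- The purely combinatorial construction of the chain. -/
lemma chain_exists {q : ℕ} (n N : ℕ) (hNn : n ≤ N) (c : Finset (Fin q) → ℕ)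
    (h0 : c ∅ < n + 1) (hN : ∀ R, c R < n + 1 → R.card ≤ N)
    (r : Finset (Fin q) → Finset (Fin q) → ℝ)
    (hr : ∀ A B, r A B = ((c B : ℝ) - (c A : ℝ)) / ((B.card : ℝ) - (A.card : ℝ)))
    (b : Finset (Fin q) → ℝ)
    (hb : ∀ A, b A = ((n : ℝ) + 1 - (c A : ℝ)) / (2 * (N : ℝ) - (n : ℝ) + 1 - (A.card : ℝ))) :
    ∃ (s : ℕ) (R : ℕ → Finset (Fin q)),
      R 0 = ∅ ∧ (∀ i, i < s → R i ⊂ R (i + 1)) ∧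
      c (R s) < n + 1 ∧
      (1 ≤ s → 0 < r (R 0) (R 1)) ∧
      (∀ i, i + 2 ≤ s → r (R i) (R (i + 1)) < r (R (i + 1)) (R (i + 2))) ∧
      (1 ≤ s → r (R (s - 1)) (R s) < b (R s)) ∧
      (∀ i, 1 ≤ i → i ≤ s → ∀ T : Finset (Fin q), R (i - 1) ⊂ T →
        c (R (i - 1)) < c T → c T < n + 1 →
          r (R (i - 1)) (R i) ≤ r (R (i - 1)) T ∧
          (r (R (i - 1)) (R i) = r (R (i - 1)) T → T.card ≤ (R i).card)) ∧
      (∀ T : Finset (Fin q), R s ⊂ T → c (R s) < c T → c T < n + 1 → b (R s) ≤ r (R s) T) := by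
  classical
  let P : Finset (Fin q) → Finset (Fin q) → Prop := fun A T => A ⊂ T ∧ c A < c T ∧ c T < n + 1
  let G : Finset (Fin q) → Prop := fun A => ∃ T, P A T ∧ r A T < b A
  have step : ∀ A, ∃ T, G A → P A T ∧ r A T < b A ∧
      ∀ U, P A U → r A T ≤ r A U ∧ (r A T = r A U → U.card ≤ T.card) := by
    intro A
    by_cases hG : G A
    · obtain ⟨T0, hT0, hlt⟩ := hG
      obtain ⟨T, hT, hopt⟩ := exists_opt (Finset.univ.filter (P A)) ⟨T0, by simp [hT0]⟩ (r A)
      simp only [Finset.mem_filter, Finset.mem_univ, true_and] at hT hopt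
      exact ⟨T, fun _ => ⟨hT, lt_of_le_of_lt (hopt T0 hT0).1 hlt, hopt⟩⟩
    · exact ⟨A, fun h => absurd h hG⟩
  choose f hf using step
  let R : ℕ → Finset (Fin q) := fun i => f^[i] ∅
  have R0 : R 0 = ∅ := rfl
  have RS : ∀ i, R (i + 1) = f (R i) := fun i => Function.iterate_succ_apply' f i ∅
  have hex : ∃ s, ¬ G (R s) := by
    by_contra! hall
    have hc : ∀ i, i ≤ (R i).card := by
      intro i
      induction i with
      | zero => simp
      | succ i ih =>
        have := Finset.card_lt_card (hf _ (hall i)).1.1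
        rw [RS]; omega
    have h1 := hc (q + 1)
    have h2 := Finset.card_le_univ (R (q + 1))
    simp only [Fintype.card_fin] at h2
    omega
  let s := Nat.find hex
  have hs : ¬ G (R s) := Nat.find_spec hex
  have hlt : ∀ i, i < s → G (R i) := fun i hi => not_not.1 (Nat.find_min hex hi)
  have hst : ∀ i, i < s → P (R i) (R (i + 1)) ∧ r (R i) (R (i + 1)) < b (R i) ∧
      ∀ U, P (R i) U → r (R i) (R (i + 1)) ≤ r (R i) U ∧
        (r (R i) (R (i + 1)) = r (R i) U → U.card ≤ (R (i + 1)).card) := by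
    intro i hi
    rw [RS]
    exact hf _ (hlt i hi)
  have hcard : ∀ A B : Finset (Fin q), A ⊂ B → (0 : ℝ) < (B.card : ℝ) - (A.card : ℝ) := by
    intro A B h
    have := Finset.card_lt_card h
    have : (A.card : ℝ) < B.card := by exact_mod_cast this
    linarith
  have hpos : ∀ A, c A < n + 1 → (0 : ℝ) < 2 * (N : ℝ) - (n : ℝ) + 1 - (A.card : ℝ) := by
    intro A h
    have h1 : (A.card : ℝ) ≤ N := by exact_mod_cast hN A h
    have h2 : (n : ℝ) ≤ N := by exact_mod_cast hNn
    linarith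
  have hcs : ∀ i, i ≤ s → c (R i) < n + 1 := by
    intro i hi
    cases i with
    | zero => simpa [R0] using h0
    | succ i => exact (hst i hi).1.2.2
  refine ⟨s, R, R0, fun i hi => (hst i hi).1.1, hcs s le_rfl, ?_, ?_, ?_, ?_, ?_⟩
  · intro h
    obtain ⟨⟨h1, h2, h3⟩, -⟩ := hst 0 h
    rw [hr]
    have : (c (R 0) : ℝ) < c (R 1) := by exact_mod_cast h2
    exact div_pos (by linarith) (hcard _ _ h1)
  · intro i hi
    obtain ⟨⟨h1, h2, h3⟩, -, hopt⟩ := hst i (by omega)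
    obtain ⟨⟨k1, k2, k3⟩, -, -⟩ := hst (i + 1) (by omega)
    have hh := hopt (R (i + 2)) ⟨h1.trans k1, h2.trans k2, k3⟩
    have hlt' : r (R i) (R (i + 1)) < r (R i) (R (i + 2)) := by
      refine lt_of_le_of_ne hh.1 fun he => ?_
      have := hh.2 he
      have := Finset.card_lt_card k1
      simp only [add_assoc] at *
      norm_num at *
      omega
    have d1 := hcard _ _ h1
    have d2 := hcard _ _ k1
    have d3 := hcard _ _ (h1.trans k1)
    rw [hr, hr, div_lt_div_iff₀ d1 d3] at hlt'
    rw [hr, hr, div_lt_div_iff₀ d1 d2]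
    simp only [add_assoc] at *
    norm_num at *
    nlinarith
  · intro h
    obtain ⟨t, ht⟩ : ∃ t, s = t + 1 := ⟨s - 1, by omega⟩
    obtain ⟨⟨h1, h2, h3⟩, hb1, -⟩ := hst t (by omega)
    rw [ht, Nat.add_sub_cancel]
    have d1 := hcard _ _ h1
    have d2 := hpos _ (h2.trans h3)
    have d3 := hpos _ h3
    rw [hr, hb, div_lt_div_iff₀ d1 d2] at hb1
    rw [hr, hb, div_lt_div_iff₀ d1 d3]
    nlinarith
  · intro i hi his T h1 h2 h3
    obtain ⟨t, rfl⟩ : ∃ t, i = t + 1 := ⟨i - 1, by omega⟩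
    exact (hst t (by omega)).2.2 T ⟨h1, h2, h3⟩
  · intro T h1 h2 h3
    by_contra! hh
    exact hs ⟨T, ⟨h1, h2, h3⟩, hh⟩

/-- A cone contained in `{0}` has dimension zero. -/
lemma coneDim_eq_zero {K : ℕ} (A : Set (Fin K → ℂ)) (hA : ∀ x ∈ A, x = 0) : coneDim A = 0 := by
  unfold coneDim
  rcases A.eq_empty_or_nonempty with rfl | ⟨x, hx⟩
  · have : vIdeal (∅ : Set (Fin K → ℂ)) = ⊤ := by
      rw [Ideal.eq_top_iff_one]
      intro x hx
      exact absurd hx (by simp)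
    have : Subsingleton (MvPolynomial (Fin K) ℂ ⧸ vIdeal (∅ : Set (Fin K → ℂ))) :=
      Ideal.Quotient.subsingleton_iff.2 this
    rw [ringKrullDim_eq_bot_of_subsingleton]
    simp
  · have hx0 := hA x hx
    subst hx0
    have hker : vIdeal A = RingHom.ker (MvPolynomial.eval (0 : Fin K → ℂ)) := by
      ext p
      constructor
      · intro hp
        exact hp 0 hx
      · intro hp y hy
        rw [hA y hy]
        exact hp
    have hmax : (vIdeal A).IsMaximal := by
      rw [hker]
      apply RingHom.ker_isMaximal_of_surjective
      intro z
      exact ⟨MvPolynomial.C z, by simp⟩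
    letI := Ideal.Quotient.field (vIdeal A)
    rw [ringKrullDim_eq_zero_of_field]
    simp

lemma vIdeal_coneOf {K : ℕ} (I : Ideal (MvPolynomial (Fin K) ℂ)) (hI : I.IsPrime) :
    vIdeal (coneOf I) = I := by
  have h := MvPolynomial.IsPrime.vanishingIdeal_zeroLocus (K := ℂ) I
  ext p
  conv_rhs => rw [← h]
  rfl

/-- **Lemma 2.4.** Existence of the Nochka chain `∅ = R₀ ⊊ R₁ ⊊ ⋯ ⊊ R_s ⊆ Q`
satisfying conditions (i)–(iv). -/
theorem statement11 {M n N q : ℕ} (hn : 1 ≤ n) (hNn : n ≤ N) (hq : 2 * N - n + 1 ≤ q)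
    (I : Ideal (MvPolynomial (Fin (M + 1)) ℂ)) (hV : IsSmoothVariety n I)
    (Q : Fin q → MvPolynomial (Fin (M + 1)) ℂ) (d : Fin q → ℕ)
    (hd : ∀ j, 1 ≤ d j) (hQ : ∀ j, (Q j).IsHomogeneous (d j))
    (hsub : InSubgenPos n N I Q) :
    ∃ (s : ℕ) (R : ℕ → Finset (Fin q)),
      R 0 = ∅ ∧ (∀ i, i < s → R i ⊂ R (i + 1)) ∧
      cdim n I Q (R s) < n + 1 ∧
      (1 ≤ s → 0 < rho n I Q (R 0) (R 1)) ∧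
      (∀ i, i + 2 ≤ s → rho n I Q (R i) (R (i + 1)) < rho n I Q (R (i + 1)) (R (i + 2))) ∧
      (1 ≤ s → rho n I Q (R (s - 1)) (R s) <
        ((n : ℝ) + 1 - (cdim n I Q (R s) : ℝ)) /
          (2 * (N : ℝ) - (n : ℝ) + 1 - ((R s).card : ℝ))) ∧
      (∀ i, 1 ≤ i → i ≤ s → ∀ T : Finset (Fin q), R (i - 1) ⊂ T →
        cdim n I Q (R (i - 1)) < cdim n I Q T → cdim n I Q T < n + 1 →
          rho n I Q (R (i - 1)) (R i) ≤ rho n I Q (R (i - 1)) T ∧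
          (rho n I Q (R (i - 1)) (R i) = rho n I Q (R (i - 1)) T →
            T.card ≤ (R i).card)) ∧
      (∀ T : Finset (Fin q), R s ⊂ T →
        cdim n I Q (R s) < cdim n I Q T → cdim n I Q T < n + 1 →
          ((n : ℝ) + 1 - (cdim n I Q (R s) : ℝ)) /
            (2 * (N : ℝ) - (n : ℝ) + 1 - ((R s).card : ℝ)) ≤ rho n I Q (R s) T) := by
  have hc0 : coneDim (interCone I Q ∅) = n + 1 := by
    have : interCone I Q ∅ = coneOf I := by simp [interCone]
    rw [this]
    unfold coneDim
    rw [vIdeal_coneOf I hV.1.1, hV.1.2.2]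
    simp only [WithBot.unbotD_coe, ENat.toNat_coe]
  refine chain_exists n N hNn (cdim n I Q) ?_ ?_ (rho n I Q) (fun _ _ => rfl) _ (fun _ => rfl)
  · unfold cdim
    rw [hc0]
    omega
  · intro R hR
    by_contra! hcard
    obtain ⟨J, hJR, hJ⟩ := Finset.exists_subset_card_eq (show N + 1 ≤ R.card from hcard)
    have : coneDim (interCone I Q R) = 0 := by
      apply coneDim_eq_zero
      intro x hx
      refine hsub.2.1 J hJ x ⟨hx.1, ?_⟩
      have := hx.2
      simp only [Set.mem_iInter] at this ⊢
      exact fun j hj => this j (hJR hj)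
    unfold cdim at hR
    omega

end SMT
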